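/- Let d ≥ 1 and let E ⊆ [0,1]^d be a compact set with E ∩ (0,1)^d ≠ ∅, and suppose there are reals λ_n ≥ 1, vectors u_n ∈ ℝ^d, and sequences x_n ∈ 2^ω such that the compact sets (λ_n K(x_n)^d + u_n) ∩ [0,1]^d converge to E in the Hausdorff metric, where K(x_n)^d is the d-fold Cartesian product of K(x_n). Then there exist x ∈ 2^ω, natural numbers m_n, a strictly increasing sequence of indices k_n, a real c > 0 and a real v (so that C = cK(x) + v is a similar copy of K(x)), an integer ℓ ≥ 1, and vectors v_1, …, v_ℓ ∈ ℝ^d such that: (1) T^{m_n}(x_{k_n}) → x in 2^ω; and (2) C^d + v_1 ⊆ E ⊆ ⋃_{i=1}^{ℓ} (C^d + v_i), where C^d is the d-fold Cartesian product of C. -/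

import Mathlib

open Filter Set
open scoped ENNReal

/-- The compact set `K(x) ⊆ [0,1]` associated to `x ∈ 2^ω`: binary expansions
`∑ a_i 2^{-(i+1)}` where `a_i ∈ {0,1}` is forced to be `0` whenever `x i = 0`. -/
def KSet (x : ℕ → Bool) : Set ℝ :=
  {r | ∃ a : ℕ → Bool, (∀ i, x i = false → a i = false) ∧
    r = ∑' i : ℕ, (if a i then ((2 : ℝ) ^ (i + 1))⁻¹ else 0)}

/-- The `m`-fold iterate of the left shift on `2^ω`. -/
def shiftIter (m : ℕ) (x : ℕ → Bool) : ℕ → Bool := fun n => x (n + m)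

noncomputable def kval (a : ℕ → Bool) : ℝ := ∑' i : ℕ, (if a i then ((2 : ℝ) ^ (i + 1))⁻¹ else 0)

lemma geo_hasSum : HasSum (fun i : ℕ => ((2 : ℝ) ^ (i + 1))⁻¹) 1 := by
  have := hasSum_geometric_two.mul_left (1/2:ℝ)
  have h2 : (fun i : ℕ => ((2 : ℝ) ^ (i + 1))⁻¹) = fun i => 1 / 2 * (1 / 2) ^ i := by
    funext i; rw [pow_succ]; simp
  rw [h2]
  have h3 : (1 / 2 * 2 : ℝ) = 1 := by norm_num
  rw [h3] at this
  exact this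

lemma kterm_nonneg (a : ℕ → Bool) (i : ℕ) : 0 ≤ (if a i then ((2 : ℝ) ^ (i + 1))⁻¹ else 0) := by
  split_ifs <;> positivity

lemma kterm_le (a : ℕ → Bool) (i : ℕ) :
    (if a i then ((2 : ℝ) ^ (i + 1))⁻¹ else 0) ≤ ((2 : ℝ) ^ (i + 1))⁻¹ := by
  split_ifs
  · exact le_rfl
  · positivity

lemma kval_summable (a : ℕ → Bool) :
    Summable (fun i : ℕ => (if a i then ((2 : ℝ) ^ (i + 1))⁻¹ else 0)) :=
  Summable.of_nonneg_of_le (kterm_nonneg a) (kterm_le a) geo_hasSum.summable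

lemma kval_mem (a : ℕ → Bool) : kval a ∈ Icc (0:ℝ) 1 := by
  constructor
  · exact tsum_nonneg (kterm_nonneg a)
  · rw [← geo_hasSum.tsum_eq]
    exact (kval_summable a).tsum_le_tsum (kterm_le a) geo_hasSum.summable

lemma kval_cont : Continuous kval := by
  unfold kval
  refine continuous_tsum (u := fun i : ℕ => ((2 : ℝ) ^ (i + 1))⁻¹) ?_ geo_hasSum.summable ?_
  · intro i
    exact (continuous_of_discreteTopology (f := fun b : Bool => if b then ((2 : ℝ) ^ (i + 1))⁻¹ else 0)).comp
      (continuous_apply i)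
  · intro i a
    rw [Real.norm_of_nonneg (kterm_nonneg a i)]
    exact kterm_le a i

lemma kval_step (a : ℕ → Bool) :
    kval a = ((if a 0 then (1:ℝ) else 0) + kval (fun i => a (i+1))) / 2 := by
  unfold kval
  rw [(kval_summable a).tsum_eq_zero_add, add_div, ← tsum_div_const]
  congr 1
  · split_ifs <;> simp
  · congr 1; ext i
    split_ifs
    · rw [pow_succ _ (i+1)]; field_simp
    · simp

lemma mem_KSet {x : ℕ → Bool} {r : ℝ} :
    r ∈ KSet x ↔ ∃ a : ℕ → Bool, (∀ i, x i = false → a i = false) ∧ r = kval a := Iff.rfl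

lemma KSet_sub {x : ℕ → Bool} {r : ℝ} (h : r ∈ KSet x) : r ∈ Icc (0:ℝ) 1 := by
  obtain ⟨a, -, rfl⟩ := mem_KSet.1 h
  exact kval_mem a

lemma KSet_step {x : ℕ → Bool} {r : ℝ} (h : r ∈ KSet x) :
    ∃ b : ℤ, (∃ k ∈ KSet (fun i => x (i+1)), r = (b + k)/2) ∧
      ∀ k ∈ KSet (fun i => x (i+1)), (b + k)/2 ∈ KSet x := by
  obtain ⟨a, ha, rfl⟩ := mem_KSet.1 h
  refine ⟨if a 0 then 1 else 0, ⟨kval (fun i => a (i+1)), ?_, ?_⟩, ?_⟩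
  · exact ⟨_, fun i hi => ha _ hi, rfl⟩
  · rw [kval_step]; push_cast; rfl
  · rintro k hk
    obtain ⟨b, hb, rfl⟩ := mem_KSet.1 hk
    refine mem_KSet.2 ⟨fun i => Nat.casesOn i (a 0) b, ?_, ?_⟩
    · rintro (_ | i) hi
      · exact ha 0 hi
      · exact hb i hi
    · rw [kval_step (fun i => Nat.casesOn i (a 0) b)]; push_cast; rfl

lemma KSet_split (M : ℕ) {x : ℕ → Bool} {r : ℝ} (h : r ∈ KSet x) :
    ∃ b : ℤ, (∃ k ∈ KSet (shiftIter M x), r = (b + k)/2^M) ∧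
      ∀ k ∈ KSet (shiftIter M x), (b + k)/2^M ∈ KSet x := by
  induction M with
  | zero => exact ⟨0, ⟨r, h, by simp⟩, fun k hk => by simpa using (show k ∈ KSet x from hk)⟩
  | succ M ih =>
    obtain ⟨b, ⟨k, hk, hr⟩, hb⟩ := ih
    obtain ⟨b', ⟨k', hk', hr'⟩, hb'⟩ := KSet_step hk
    have hs : (fun i => shiftIter M x (i+1)) = shiftIter (M+1) x := by
      ext i; simp only [shiftIter]; congr 1; ring
    rw [hs] at hk' hb'
    refine ⟨2*b+b', ⟨k', hk', ?_⟩, fun k'' hk'' => ?_⟩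
    · rw [hr, hr']; push_cast; field_simp; ring
    · convert hb _ (hb' _ hk'') using 1
      push_cast; field_simp; ring

lemma KSet_lim {z : ℕ → ℕ → Bool} {y : ℕ → Bool} (hz : Tendsto z atTop (nhds y))
    {k : ℕ → ℝ} {k0 : ℝ} (hk : ∀ n, k n ∈ KSet (z n)) (hk0 : Tendsto k atTop (nhds k0)) :
    k0 ∈ KSet y := by
  choose a ha hka using fun n => mem_KSet.1 (hk n)
  obtain ⟨a0, -, φ, hφ, hlim⟩ := (isCompact_univ (X := ℕ → Bool)).tendsto_subseq
    (x := a) (fun n => mem_univ _)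
  refine mem_KSet.2 ⟨a0, fun i hi => ?_, ?_⟩
  · have h1 := (tendsto_pi_nhds.1 (hz.comp hφ.tendsto_atTop)) i
    have h2 := (tendsto_pi_nhds.1 hlim) i
    rw [nhds_discrete, tendsto_pure] at h1 h2
    obtain ⟨n, h1, h2⟩ := (h1.and h2).exists
    simp only [Function.comp] at h1 h2
    rw [← h2]; exact ha _ _ (h1.trans hi)
  · refine tendsto_nhds_unique (hk0.comp hφ.tendsto_atTop) ?_
    convert (kval_cont.tendsto a0).comp hlim using 1
    ext n; simp [hka]

lemma KSet_approx {z : ℕ → ℕ → Bool} {y : ℕ → Bool} (hz : Tendsto z atTop (nhds y))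
    {k0 : ℝ} (hk : k0 ∈ KSet y) :
    ∃ k : ℕ → ℝ, (∀ n, k n ∈ KSet (z n)) ∧ Tendsto k atTop (nhds k0) := by
  obtain ⟨a, ha, rfl⟩ := mem_KSet.1 hk
  refine ⟨fun n => kval (fun i => a i && z n i), fun n => mem_KSet.2 ⟨_, ?_, rfl⟩, ?_⟩
  · intro i hi; simp [hi]
  · refine (kval_cont.tendsto a).comp (tendsto_pi_nhds.2 fun i => ?_)
    have h1 := (tendsto_pi_nhds.1 hz) i
    rw [nhds_discrete, tendsto_pure] at h1 ⊢
    filter_upwards [h1] with n hn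
    rw [hn]
    cases hy : y i
    · simp [ha i hy]
    · simp

/-- decomposition of a point in the magnified set -/
lemma decomp {d : ℕ} (s M : ℕ) (l c : ℝ) (hc : c = l / 2^M) (hc1 : 1 ≤ c * 2^s) (hc0 : 0 < c)
    (x : ℕ → Bool) (u : Fin d → ℝ)
    (p : Fin d → ℝ)
    (hp : p ∈ ((fun z => l • z + u) '' Set.univ.pi fun _ : Fin d => KSet x) ∩
          Set.univ.pi fun _ => Set.Icc (0 : ℝ) 1) :
    ∃ j ∈ Icc (fun _ : Fin d => (-2 : ℤ)) (fun _ => 2^s), ∃ k ∈ Icc (fun _ : Fin d => (0:ℝ)) (fun _ => 1),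
      (∀ i, k i ∈ KSet (shiftIter M x)) ∧
      (∀ i, p i = c * (j i + k i) + c * Int.fract (u i / c)) ∧
      ∀ k' : Fin d → ℝ, (∀ i, k' i ∈ KSet (shiftIter M x)) →
        (fun i => c * (j i + k' i) + c * Int.fract (u i / c)) ∈
          ((fun z => l • z + u) '' Set.univ.pi fun _ : Fin d => KSet x) := by
  obtain ⟨⟨z, hz, rfl⟩, hp⟩ := hp
  choose b hb hb' using fun i => KSet_split M (hz i trivial)
  choose k hk hzk using hb
  have hl : l = c * 2^M := by rw [hc]; field_simp
  have hu : ∀ i, c * Int.fract (u i / c) = u i - c * ⌊u i / c⌋ := by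
    intro i
    rw [← Int.self_sub_floor]; field_simp
  have e1 : ∀ i, (l • z + u) i = c * (((b i + ⌊u i / c⌋ : ℤ) : ℝ) + k i) + c * Int.fract (u i / c) := by
    intro i
    rw [hu]
    simp only [Pi.add_apply, Pi.smul_apply, smul_eq_mul]
    rw [hzk, hl]; push_cast; field_simp; ring
  have hk1 : ∀ i, k i ∈ Icc (0:ℝ) 1 := fun i => KSet_sub (hk i)
  have hj : ∀ i, -2 ≤ b i + ⌊u i / c⌋ ∧ b i + ⌊u i / c⌋ ≤ 2^s := by
    intro i
    have h := hp i trivial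
    simp only at h
    rw [e1 i] at h
    have f0 := Int.fract_nonneg (u i / c)
    have f1 := (Int.fract_lt_one (u i / c)).le
    generalize (b i + ⌊u i / c⌋) = J at *
    obtain ⟨h1, h2⟩ := h
    have k1 := (hk1 i).1
    have k2 := (hk1 i).2
    constructor
    · have : (-2:ℝ) ≤ J := by
        by_contra hh
        push Not at hh
        have : c * ((J + k i) + Int.fract (u i / c)) < 0 := mul_neg_of_pos_of_neg hc0 (by linarith)
        linarith
      exact_mod_cast this
    · have : (J:ℝ) ≤ 2^s := by
        by_contra hh
        push Not at hh
        have : c * 2^s < c * ((J + k i) + Int.fract (u i / c)) := mul_lt_mul_of_pos_left (by linarith) hc0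
        linarith
      exact_mod_cast this
  refine ⟨fun i => b i + ⌊u i / c⌋, ⟨fun i => (hj i).1, fun i => (hj i).2⟩, k,
    ⟨fun i => (hk1 i).1, fun i => (hk1 i).2⟩, hk, e1, fun k' hk' => ?_⟩
  refine ⟨fun i => (b i + k' i)/2^M, fun i _ => hb' i _ (hk' i), ?_⟩
  ext i
  rw [hu]
  simp only [Pi.add_apply, Pi.smul_apply, smul_eq_mul]
  rw [hl]; push_cast; field_simp; ring

lemma enum {α : Type*} (S : Set α) (hS : S.Finite) (j0 : α) :
    ∃ (ℓ : ℕ) (hℓ : 0 < ℓ) (f : Fin ℓ → α), f ⟨0, hℓ⟩ = j0 ∧ ∀ j ∈ S, ∃ i, f i = j := by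
  obtain ⟨n, f, hf⟩ := Set.Finite.fin_embedding hS
  refine ⟨n+1, Nat.succ_pos _, Fin.cons j0 f, rfl, fun j hj => ?_⟩
  rw [← hf] at hj
  obtain ⟨i, rfl⟩ := hj
  exact ⟨i.succ, rfl⟩

/-- points of the limit are approximated along a subsequence -/
lemma haus_approx {α : Type*} [PseudoMetricSpace α] {A : ℕ → Set α} {E : Set α}
    (h : Tendsto (fun n => Metric.hausdorffEDist (A n) E) atTop (nhds 0)) {e : α} (he : e ∈ E) :
    ∃ φ : ℕ → ℕ, StrictMono φ ∧ ∃ a : ℕ → α, (∀ n, a n ∈ A (φ n)) ∧ Tendsto a atTop (nhds e) := by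
  have h1 : ∀ n : ℕ, ∀ᶠ k in atTop, ∃ a ∈ A k, edist e a < ((n : ℝ≥0∞) + 1)⁻¹ := by
    intro n
    have hpos : (0:ℝ≥0∞) < ((n : ℝ≥0∞) + 1)⁻¹ := by
      rw [ENNReal.inv_pos]; simp
    filter_upwards [h.eventually (gt_mem_nhds hpos)] with k hk
    rw [Metric.hausdorffEDist_comm] at hk
    exact Metric.exists_edist_lt_of_hausdorffEDist_lt he hk
  obtain ⟨φ, hφ, hp⟩ := extraction_forall_of_eventually h1
  choose a ha hd using hp
  refine ⟨φ, hφ, a, ha, ?_⟩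
  rw [tendsto_iff_edist_tendsto_0]
  have h0 : Tendsto (fun n : ℕ => ((n : ℝ≥0∞) + 1)⁻¹) atTop (nhds 0) := by
    have := (tendsto_add_atTop_iff_nat 1).2 ENNReal.tendsto_inv_nat_nhds_zero
    simpa using this
  refine tendsto_of_tendsto_of_tendsto_of_le_of_le tendsto_const_nhds h0 (fun n => bot_le) ?_
  intro n
  show edist (a n) e ≤ _
  rw [edist_comm]
  exact (hd n).le

lemma haus_lim {α : Type*} [PseudoMetricSpace α] {A : ℕ → Set α} {E : Set α} (hE : IsClosed E)
    (h : Tendsto (fun n => Metric.hausdorffEDist (A n) E) atTop (nhds 0)) {z : ℕ → α} {e : α}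
    (hz : ∀ᶠ n in atTop, z n ∈ A n) (hlim : Tendsto z atTop (nhds e)) : e ∈ E := by
  rw [← hE.closure_eq, Metric.mem_closure_iff_infEDist_zero]
  have h1 : Tendsto (fun n => Metric.infEDist (z n) E) atTop (nhds (Metric.infEDist e E)) :=
    (Metric.continuous_infEDist.tendsto e).comp hlim
  refine tendsto_nhds_unique h1 ?_
  refine tendsto_of_tendsto_of_tendsto_of_le_of_le' tendsto_const_nhds h
    (Eventually.of_forall fun n => bot_le) ?_
  filter_upwards [hz] with n hn
  exact Metric.infEDist_le_hausdorffEDist_of_mem hn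

lemma lim_formula {d : ℕ} {c : ℕ → ℝ} {c0 : ℝ} (hc : Tendsto c atTop (nhds c0))
    {r k : ℕ → Fin d → ℝ} {r0 k0 : Fin d → ℝ} (hr : Tendsto r atTop (nhds r0))
    (hk : Tendsto k atTop (nhds k0)) {j : ℕ → Fin d → ℤ} {j0 : Fin d → ℤ}
    (hj : Tendsto j atTop (nhds j0)) :
    Tendsto (fun n => fun i => c n * (j n i + k n i) + r n i) atTop
      (nhds (fun i => c0 * (j0 i + k0 i) + r0 i)) := by
  rw [tendsto_pi_nhds] at *
  intro i
  have hji : Tendsto (fun n => (j n i : ℝ)) atTop (nhds (j0 i : ℝ)) :=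
    ((continuous_of_discreteTopology (f := fun q : ℤ => (q:ℝ))).tendsto _).comp (hj i)
  exact (hc.mul (hji.add (hk i))).add (hr i)

/-- If `(λ_n K(x_n)^d + u_n) ∩ [0,1]^d` converges in the Hausdorff metric to a compact
set `E ⊆ [0,1]^d` meeting `(0,1)^d`, then there are `y ∈ 2^ω`, shifts `m_n`, indices
`k_n ↑ ∞`, a similar copy `C = cK(y) + v` of `K(y)`, and vectors `v_1, …, v_ℓ` such that
`T^{m_n}(x_{k_n}) → y` and `C^d + v_1 ⊆ E ⊆ ⋃_{i≤ℓ} (C^d + v_i)`. -/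
theorem statement16 (d : ℕ) (hd : 1 ≤ d) (E : Set (Fin d → ℝ)) (hEc : IsCompact E)
    (hEsub : E ⊆ Set.univ.pi fun _ => Set.Icc (0 : ℝ) 1)
    (hEint : (E ∩ Set.univ.pi fun _ => Set.Ioo (0 : ℝ) 1).Nonempty)
    (lam : ℕ → ℝ) (hlam : ∀ n, 1 ≤ lam n) (u : ℕ → Fin d → ℝ) (x : ℕ → ℕ → Bool)
    (hconv : Filter.Tendsto
      (fun n => EMetric.hausdorffEdist
        (((fun z => lam n • z + u n) '' Set.univ.pi fun _ : Fin d => KSet (x n)) ∩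
          Set.univ.pi fun _ => Set.Icc (0 : ℝ) 1) E)
      Filter.atTop (nhds 0)) :
    ∃ (y : ℕ → Bool) (m : ℕ → ℕ) (k : ℕ → ℕ) (c v : ℝ) (ℓ : ℕ) (hℓ : 0 < ℓ)
      (vv : Fin ℓ → Fin d → ℝ),
      0 < c ∧ StrictMono k ∧
      Filter.Tendsto (fun n => shiftIter (m n) (x (k n))) Filter.atTop (nhds y) ∧
      ((fun z => z + vv ⟨0, hℓ⟩) ''
          Set.univ.pi (fun _ : Fin d => (fun r => c * r + v) '' KSet y)) ⊆ E ∧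
      E ⊆ ⋃ i : Fin ℓ, (fun z => z + vv i) ''
          Set.univ.pi (fun _ : Fin d => (fun r => c * r + v) '' KSet y) := by
  set A : ℕ → Set (Fin d → ℝ) := fun n =>
    ((fun z => lam n • z + u n) '' Set.univ.pi fun _ : Fin d => KSet (x n)) ∩
          Set.univ.pi fun _ => Set.Icc (0 : ℝ) 1 with hA
  have hH : Tendsto (fun n => Metric.hausdorffEDist (A n) E) atTop (nhds 0) := hconv
  clear hconv
  obtain ⟨e, heE, he⟩ := hEint
  -- margin
  obtain ⟨s, hs⟩ : ∃ s : ℕ, ∀ i, (2:ℝ) * (1/2)^s < e i ∧ (2:ℝ) * (1/2)^s < 1 - e i := by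
    have h0 : Tendsto (fun s : ℕ => (2:ℝ) * (1/2)^s) atTop (nhds 0) := by
      simpa using (tendsto_pow_atTop_nhds_zero_of_lt_one (r := (1/2:ℝ)) (by norm_num)
        (by norm_num)).const_mul 2
    have : ∀ᶠ s : ℕ in atTop, ∀ i, (2:ℝ) * (1/2)^s < e i ∧ (2:ℝ) * (1/2)^s < 1 - e i := by
      rw [eventually_all]
      intro i
      have := he i trivial
      exact (h0.eventually (gt_mem_nhds this.1)).and
        (h0.eventually (gt_mem_nhds (sub_pos.2 this.2)))
    exact this.exists
  choose q hq1 hq2 using fun n => exists_nat_pow_near (hlam n) (one_lt_two (α := ℝ))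
  set M : ℕ → ℕ := fun n => q n + s with hM
  set c : ℕ → ℝ := fun n => lam n / 2 ^ (M n) with hcdef
  have hcs : ∀ n, c n * 2 ^ s = lam n / 2 ^ (q n) := by
    intro n; simp only [hcdef, hM, pow_add]; field_simp
  have hc1 : ∀ n, 1 ≤ c n * 2 ^ s := by
    intro n; rw [hcs, le_div_iff₀ (by positivity)]; simpa using hq1 n
  have hc2 : ∀ n, c n * 2 ^ s ≤ 2 := by
    intro n; rw [hcs, div_le_iff₀ (by positivity)]
    have := (hq2 n).le
    rw [pow_succ] at this; linarith
  have hcI : ∀ n, c n ∈ Icc ((1/2:ℝ)^s) (2 * (1/2)^s) := by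
    intro n
    have e2 : (1/2:ℝ)^s * 2^s = 1 := by rw [← mul_pow]; norm_num
    have hp : (0:ℝ) < 2^s := by positivity
    constructor
    · refine le_of_mul_le_mul_right ?_ hp
      rw [e2]; exact hc1 n
    · refine le_of_mul_le_mul_right ?_ hp
      rw [mul_assoc, e2]; linarith [hc2 n]
  have hsp : (0:ℝ) < (1/2)^s := by positivity
  have hcpos : ∀ n, 0 < c n := fun n => hsp.trans_le (hcI n).1
  set r : ℕ → Fin d → ℝ := fun n i => c n * Int.fract (u n i / c n) with hr
  have hrI : ∀ n, r n ∈ Icc (fun _ : Fin d => (0:ℝ)) (fun _ => 2 * (1/2)^s) := by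
    intro n
    constructor
    · intro i; exact mul_nonneg (hcpos n).le (Int.fract_nonneg _)
    · intro i
      refine le_trans ?_ (hcI n).2
      exact mul_le_of_le_one_right (hcpos n).le (Int.fract_lt_one _).le
  have dec := fun n (p : Fin d → ℝ) (hp : p ∈ A n) =>
    decomp s (M n) (lam n) (c n) rfl (hc1 n) (hcpos n) (x n) (u n) p hp
  -- first subsequence
  obtain ⟨φ0, hφ0, a, ha, hae⟩ := haus_approx hH heE
  choose j hj k hk hkK hak hpiece using fun n => dec (φ0 n) (a n) (ha n)
  have hZfin : (Icc (fun _ : Fin d => (-2 : ℤ)) (fun _ => 2^s)).Finite := Set.finite_Icc _ _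
  obtain ⟨⟨y, c0, r0, j0, k0⟩, hmem, φ1, hφ1, hlim⟩ :=
    ((isCompact_univ (X := ℕ → Bool)).prod ((isCompact_Icc (a := (1/2:ℝ)^s) (b := 2 * (1/2)^s)).prod
      ((isCompact_Icc (a := fun _ : Fin d => (0:ℝ)) (b := fun _ => 2 * (1/2)^s)).prod
        (hZfin.isCompact.prod
          (isCompact_Icc (a := fun _ : Fin d => (0:ℝ)) (b := fun _ => 1)))))).tendsto_subseq
      (x := fun n => (shiftIter (M (φ0 n)) (x (φ0 n)), c (φ0 n), r (φ0 n), j n, k n))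
      (fun n => ⟨mem_univ _, hcI _, hrI _, hj n, hk n⟩)
  obtain ⟨-, hc0, -, hj0, -⟩ := hmem
  rw [nhds_prod_eq, nhds_prod_eq, nhds_prod_eq, nhds_prod_eq, tendsto_prod_iff', tendsto_prod_iff',
    tendsto_prod_iff', tendsto_prod_iff'] at hlim
  obtain ⟨ly, lc, lr, lj, lk⟩ := hlim
  simp only [Function.comp_def] at ly lc lr lj lk
  have hκ : StrictMono (fun n => φ0 (φ1 n)) := hφ0.comp hφ1
  have hc0pos : 0 < c0 := hsp.trans_le hc0.1
  -- the special point
  have hk0K : ∀ i, k0 i ∈ KSet y := fun i =>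
    KSet_lim ly (fun n => hkK (φ1 n) i) (tendsto_pi_nhds.1 lk i)
  have hesp : e = fun i => c0 * (j0 i + k0 i) + r0 i := by
    refine tendsto_nhds_unique (hae.comp hφ1.tendsto_atTop) ?_
    convert lim_formula lc lr lk lj using 1
    ext n i
    exact hak (φ1 n) i
  obtain ⟨ℓ, hℓ, f, hf0, hf⟩ := enum _ hZfin j0
  refine ⟨y, fun n => M (φ0 (φ1 n)), fun n => φ0 (φ1 n), c0, 0, ℓ, hℓ,
    fun t i => c0 * (f t i) + r0 i, hc0pos, hκ, ly, ?_, ?_⟩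
  · rintro _ ⟨z, hz, rfl⟩
    choose w hwK hw using fun i => hz i trivial
    choose kk hkk hkl using fun i => KSet_approx ly (hwK i)
    have hkl' : Tendsto (fun n i => kk i n) atTop (nhds w) := tendsto_pi_nhds.2 hkl
    have L := lim_formula lc lr hkl' lj
    have hpt : (fun i => c0 * (j0 i + w i) + r0 i) =
        z + fun i => c0 * (f ⟨0, hℓ⟩ i) + r0 i := by
      ext i
      simp only [Pi.add_apply, hf0, ← hw i]; ring
    show z + (fun i => c0 * (f ⟨0, hℓ⟩ i) + r0 i) ∈ E
    rw [← hpt]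
    refine haus_lim hEc.isClosed (hH.comp hκ.tendsto_atTop) ?_ L
    have hop : IsOpen (Set.univ.pi fun _ : Fin d => Set.Ioo (0:ℝ) 1) :=
      isOpen_set_pi finite_univ (fun _ _ => isOpen_Ioo)
    have hin : (fun i => c0 * (j0 i + w i) + r0 i) ∈ Set.univ.pi fun _ : Fin d => Set.Ioo (0:ℝ) 1 := by
      intro i _
      have h1 := hs i
      have h2 : e i = c0 * (j0 i + k0 i) + r0 i := congrFun hesp i
      have h3 := KSet_sub (hk0K i)
      have h4 := KSet_sub (hwK i)
      have h5 := hc0.2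
      have h6 : c0 * (w i - k0 i) ≤ c0 * 1 :=
        mul_le_mul_of_nonneg_left (by linarith [h3.1, h4.2]) hc0pos.le
      have h7 : c0 * (k0 i - w i) ≤ c0 * 1 :=
        mul_le_mul_of_nonneg_left (by linarith [h4.1, h3.2]) hc0pos.le
      constructor <;> simp only <;> linarith [h1.1, h1.2]
    filter_upwards [L.eventually (hop.mem_nhds hin)] with n hn
    refine ⟨hpiece (φ1 n) (fun i => kk i n) (fun i => hkk i n), fun i hi => ?_⟩
    exact Ioo_subset_Icc_self (hn i hi)
  · intro p hp
    obtain ⟨ψ, hψ, b, hb, hbp⟩ := haus_approx (hH.comp hκ.tendsto_atTop) hp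
    choose j' hj' k' hk' hkK' hbk' _ using fun n => dec _ (b n) (hb n)
    obtain ⟨⟨j1, k1⟩, hmem, φ2, hφ2, hlim⟩ := (hZfin.isCompact.prod
          (isCompact_Icc (a := fun _ : Fin d => (0:ℝ)) (b := fun _ => 1))).tendsto_subseq
      (x := fun n => (j' n, k' n)) (fun n => ⟨hj' n, hk' n⟩)
    rw [nhds_prod_eq, tendsto_prod_iff'] at hlim
    obtain ⟨lj', lk'⟩ := hlim
    simp only [Function.comp_def] at lj' lk'
    have hsub : Tendsto (fun n => ψ (φ2 n)) atTop atTop := (hψ.comp hφ2).tendsto_atTop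
    have hk1 : ∀ i, k1 i ∈ KSet y := fun i =>
      KSet_lim (ly.comp hsub) (fun n => hkK' (φ2 n) i) (tendsto_pi_nhds.1 lk' i)
    have hpe : p = fun i => c0 * (j1 i + k1 i) + r0 i := by
      refine tendsto_nhds_unique (hbp.comp hφ2.tendsto_atTop) ?_
      convert lim_formula (lc.comp hsub) (lr.comp hsub) lk' lj' using 1
      ext n i
      exact hbk' (φ2 n) i
    obtain ⟨t, ht⟩ := hf j1 hmem.1
    refine mem_iUnion.2 ⟨t, fun i => c0 * k1 i + 0, fun i _ => ⟨k1 i, hk1 i, rfl⟩, ?_⟩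
    rw [hpe]
    ext i
    simp only [Pi.add_apply, ht]; ring
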